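/- Let n ≥ 1 and let L₀, L₁ be Lagrangian subspaces of ℂⁿ with L₀ ∩ L₁ = {0}. Let C be an ℝ-linear automorphism of ℂⁿ preserving ω₀ with C(L₀) = ℝⁿ and C(L₁) = iℝⁿ, and let C' be an ℝ-linear automorphism of ℂⁿ preserving ω₀ with C'(L₁) = ℝⁿ and C'(L₀) = iℝⁿ. Define the canonical short paths λ₊(t) := C⁻¹(e^{−iπt/2}·ℝⁿ) and λ₋(t) := C'⁻¹(e^{−iπt/2}·ℝⁿ) for t ∈ [0,1]. Suppose β₊, β₋ : [0,1] → ℂ satisfy: for every t ∈ [0,1] and every A ∈ U(n) with A·ℝⁿ = λ₊(t) one has β₊(t) = det(A)², and for every A ∈ U(n) with A·ℝⁿ = λ₋(t) one has β₋(t) = det(A)². Let a₀, a₁ ∈ ℝ and let α̃₊, α̃₋ : [0,1] → ℝ be continuous with exp(2πi·α̃₊(t)) = β₊(t) and exp(2πi·α̃₋(t)) = β₋(t) for all t, α̃₊(0) = a₀, and α̃₋(0) = a₁. Then (a₁ − α̃₊(1)) + (a₀ − α̃₋(1)) = n. -/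

import Mathlib

open Matrix

/-- For a complex `n × n` matrix `A`, the real subspace `A · ℝⁿ` of `ℂⁿ`:
the image of `ℝⁿ ⊆ ℂⁿ` under the `ℝ`-linear map `v ↦ A v`. -/
noncomputable def realLag {n : ℕ} (A : Matrix (Fin n) (Fin n) ℂ) :
    Submodule ℝ (Fin n → ℂ) :=
  Submodule.map
    (((A.mulVecLin).restrictScalars ℝ).comp ((Algebra.linearMap ℝ ℂ).compLeft (Fin n))) ⊤

/-- The real subspace `c · ℝⁿ` of `ℂⁿ`: the image of `ℝⁿ ⊆ ℂⁿ` under scalar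
multiplication by the complex number `c`. -/
noncomputable def rotReal (n : ℕ) (c : ℂ) : Submodule ℝ (Fin n → ℂ) :=
  Submodule.map
    (((LinearMap.lsmul ℂ (Fin n → ℂ) c).restrictScalars ℝ).comp
      ((Algebra.linearMap ℝ ℂ).compLeft (Fin n))) ⊤

/-- The standard symplectic form `ω₀(v,w) = Im ⟪v,w⟫` on `ℂⁿ` viewed as a real
vector space, where `⟪·,·⟫` is the standard Hermitian inner product. -/
noncomputable def omegaC (n : ℕ) (v w : Fin n → ℂ) : ℝ :=
  (∑ i : Fin n, (starRingEnd ℂ) (v i) * w i).im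

section
open scoped ComplexOrder

lemma s8_lift2 (H : ℝ × ℝ → ℂ) (hc : Continuous H)
    (h0 : ∀ v ∈ Set.Icc (0:ℝ) 1, ∀ t ∈ Set.Icc (0:ℝ) 1, H (v, t) ≠ 0) :
    ∃ l : ℝ × ℝ → ℂ, Continuous l ∧
      ∀ v ∈ Set.Icc (0:ℝ) 1, ∀ t ∈ Set.Icc (0:ℝ) 1, Complex.exp (l (v, t)) = H (v, t) := by
  let cl : ℝ → ℝ := fun x => max 0 (min 1 x)
  have hcl : Continuous cl := by fun_prop
  have hmem : ∀ x, cl x ∈ Set.Icc (0:ℝ) 1 := fun x => by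
    simp [cl]
  have hid : ∀ x ∈ Set.Icc (0:ℝ) 1, cl x = x := fun x hx => by
    simp [cl, hx.1, hx.2]
  let f : C(ℝ × ℝ, ℂ) := ⟨fun p => H (cl p.1, cl p.2), by fun_prop⟩
  have hne : ∀ a, f a ∈ ({0}ᶜ : Set ℂ) := fun a => h0 _ (hmem _) _ (hmem _)
  obtain ⟨F, ⟨-, hF⟩, -⟩ := Complex.isCoveringMapOn_exp.existsUnique_continuousMap_lifts f
    (a₀ := (0, 0)) (e₀ := Complex.log (f (0,0))) (Complex.exp_log (hne _)) hne
  refine ⟨F, F.continuous, fun v hv t ht => ?_⟩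
  have := congrFun hF (v, t)
  simpa [f, hid v hv, hid t ht] using this

lemma s8_disc (f : ℝ → ℝ) (hf : ContinuousOn f (Set.Icc 0 1)) (δ : ℝ) (hδ : 0 < δ)
    (h : ∀ t ∈ Set.Icc (0:ℝ) 1, ∃ k : ℤ, f t - f 0 = k * δ) : f 1 = f 0 := by
  have h1 : ContinuousOn (fun t => (f t - f 0) / δ) (Set.Icc 0 1) := by fun_prop
  have hd : IsDiscrete (Set.range ((↑) : ℤ → ℝ)) := by
    exact Int.isClosedEmbedding_coe_real.isEmbedding.isInducing.isDiscrete_range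
  have := isPreconnected_Icc.eqOn_const_of_mapsTo (T := Set.range ((↑) : ℤ → ℝ)) hd h1
    (fun t ht => by
      obtain ⟨k, hk⟩ := h t ht
      exact ⟨k, by simp [hk, hδ.ne']⟩) ⟨0, by simp⟩
  obtain ⟨y, hy, hE⟩ := this
  have e0 := hE (show (0:ℝ) ∈ Set.Icc (0:ℝ) 1 by simp)
  have e1 := hE (show (1:ℝ) ∈ Set.Icc (0:ℝ) 1 by simp)
  simp at e0 e1
  rw [← e0] at e1
  simp [hδ.ne'] at e1
  linarith

lemma s8_alpha (α : ℝ → ℝ) (hα : ContinuousOn α (Set.Icc 0 1)) (l : ℝ → ℂ) (hl : Continuous l)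
    (c : ℂ) (hc : c ≠ 0)
    (h : ∀ t ∈ Set.Icc (0:ℝ) 1, Complex.exp (2 * Real.pi * Complex.I * (α t)) =
      (c * Complex.exp (l t)) ^ 2 / (‖c * Complex.exp (l t)‖ : ℂ) ^ 2) :
    Real.pi * (α 1 - α 0) = (l 1).im - (l 0).im := by
  have key : ∀ t ∈ Set.Icc (0:ℝ) 1,
      Complex.exp (((2 * Real.pi * α t - 2 * (l t).im : ℝ) : ℂ) * Complex.I) = c ^ 2 / (‖c‖ : ℂ) ^ 2 := by
    intro t ht
    have h1 := h t ht
    have h2 : (Complex.exp (l t)) ^ 2 / (‖Complex.exp (l t)‖ : ℂ) ^ 2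
        = Complex.exp (((2 * (l t).im : ℝ) : ℂ) * Complex.I) := by
      rw [Complex.norm_exp, Complex.ofReal_exp, ← Complex.exp_nat_mul, ← Complex.exp_nat_mul,
        ← Complex.exp_sub]
      congr 1
      apply Complex.ext <;> simp
    have h3 : Complex.exp (((2 * Real.pi * α t : ℝ) : ℂ) * Complex.I) =
        (c ^ 2 / (‖c‖ : ℂ) ^ 2) * Complex.exp (((2 * (l t).im : ℝ) : ℂ) * Complex.I) := by
      rw [← h2, ← mul_div_mul_comm, ← mul_pow, ← mul_pow, ← Complex.ofReal_mul, ← norm_mul, ← h1]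
      congr 1; push_cast; ring
    rw [Complex.ofReal_sub, sub_mul, Complex.exp_sub, h3, mul_div_assoc, div_self (Complex.exp_ne_zero _), mul_one]
  have := s8_disc (fun t => 2 * Real.pi * α t - 2 * (l t).im) (by
      have : Continuous fun t => (l t).im := Complex.continuous_im.comp hl
      fun_prop) (2 * Real.pi) (by positivity) (fun t ht => by
      have := (key t ht).trans (key 0 (by simp)).symm
      rw [Complex.exp_eq_exp_iff_exists_int] at this
      obtain ⟨k, hk⟩ := this
      refine ⟨k, ?_⟩
      have := congrArg Complex.im hk
      simp at this
      linarith)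
  linarith

lemma s8_det_ne {n : ℕ} (W : Matrix (Fin n) (Fin n) ℂ)
    (h : ∀ w, w ≠ 0 → star w ⬝ᵥ (W *ᵥ w) ≠ 0) : W.det ≠ 0 := by
  intro hd
  obtain ⟨w, hw, hz⟩ := Matrix.exists_mulVec_eq_zero_iff.mpr hd
  exact h w hw (by simp [hz])

lemma s8_total {n : ℕ} (G Z : Matrix (Fin n) (Fin n) ℂ) (hG : G.PosDef)
    (hZ : ∀ w, w ≠ 0 → 0 < (star w ⬝ᵥ (Z *ᵥ w)).im) :
    ∃ lp lm : ℝ → ℂ, Continuous lp ∧ Continuous lm ∧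
      (∀ t ∈ Set.Icc (0:ℝ) 1, Complex.exp (lp t) =
        ((Real.cos (Real.pi * t / 2) : ℂ) • (1 : Matrix (Fin n) (Fin n) ℂ)
          - (Real.sin (Real.pi * t / 2) : ℂ) • Z).det) ∧
      (∀ t ∈ Set.Icc (0:ℝ) 1, Complex.exp (lm t) =
        ((Real.sin (Real.pi * t / 2) : ℂ) • G + (Real.cos (Real.pi * t / 2) : ℂ) • Z).det) ∧
      ((lp 1).im - (lp 0).im) + ((lm 1).im - (lm 0).im) = - (n * Real.pi) := by
  let Gv : ℝ → Matrix (Fin n) (Fin n) ℂ := fun v => ((1 - v : ℝ) : ℂ) • G + (v : ℂ) • 1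
  let Zv : ℝ → Matrix (Fin n) (Fin n) ℂ := fun v => ((1 - v : ℝ) : ℂ) • Z + (v : ℂ) • (Complex.I • 1)
  have hself : ∀ w : Fin n → ℂ, w ≠ 0 → 0 < (star w ⬝ᵥ w).re ∧ (star w ⬝ᵥ w).im = 0 := by
    intro w hw
    have := dotProduct_star_self_pos_iff.mpr hw
    rw [Complex.lt_def] at this
    exact ⟨this.1, this.2.symm⟩
  have hGq : ∀ w, w ≠ 0 → 0 < (star w ⬝ᵥ (G *ᵥ w)).re ∧ (star w ⬝ᵥ (G *ᵥ w)).im = 0 := by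
    intro w hw
    have := hG.dotProduct_mulVec_pos hw
    rw [Complex.lt_def] at this
    exact ⟨this.1, this.2.symm⟩
  have hGv : ∀ v ∈ Set.Icc (0:ℝ) 1, ∀ w, w ≠ 0 →
      0 < (star w ⬝ᵥ (Gv v *ᵥ w)).re ∧ (star w ⬝ᵥ (Gv v *ᵥ w)).im = 0 := by
    intro v hv w hw
    obtain ⟨a, b⟩ := hself w hw
    obtain ⟨a', b'⟩ := hGq w hw
    simp only [Gv, Matrix.add_mulVec, Matrix.smul_mulVec, dotProduct_add, dotProduct_smul,
      Matrix.one_mulVec, smul_eq_mul, Complex.add_re, Complex.add_im, Complex.re_ofReal_mul,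
      Complex.im_ofReal_mul, b, b']
    refine ⟨?_, by simp⟩
    rcases hv.1.eq_or_lt with h | h
    · subst h; simpa using a'
    · have := hv.2
      have h2 : 0 ≤ (1 - v) * (star w ⬝ᵥ (G *ᵥ w)).re := mul_nonneg (by linarith) a'.le
      have := mul_pos h a
      linarith
  have hZv : ∀ v ∈ Set.Icc (0:ℝ) 1, ∀ w, w ≠ 0 → 0 < (star w ⬝ᵥ (Zv v *ᵥ w)).im := by
    intro v hv w hw
    obtain ⟨a, b⟩ := hself w hw
    have a' := hZ w hw
    simp only [Zv, Matrix.add_mulVec, Matrix.smul_mulVec, dotProduct_add, dotProduct_smul,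
      Matrix.one_mulVec, smul_eq_mul, Complex.add_re, Complex.add_im, Complex.re_ofReal_mul,
      Complex.im_ofReal_mul, Complex.I_mul_im]
    rcases hv.1.eq_or_lt with h | h
    · subst h; simpa using a'
    · have := hv.2
      have h2 : 0 ≤ (1 - v) * (star w ⬝ᵥ (Z *ᵥ w)).im := mul_nonneg (by linarith) a'.le
      have := mul_pos h a
      linarith
  let Hp : ℝ × ℝ → ℂ := fun p => ((Real.cos (Real.pi * p.2 / 2) : ℂ) • (1 : Matrix (Fin n) (Fin n) ℂ)
          - (Real.sin (Real.pi * p.2 / 2) : ℂ) • Zv p.1).det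
  let Hm : ℝ × ℝ → ℂ := fun p => ((Real.sin (Real.pi * p.2 / 2) : ℂ) • Gv p.1
          + (Real.cos (Real.pi * p.2 / 2) : ℂ) • Zv p.1).det
  have hsin : ∀ t ∈ Set.Icc (0:ℝ) 1, t ≠ 0 → 0 < Real.sin (Real.pi * t / 2) := by
    intro t ht h0
    have : 0 < t := lt_of_le_of_ne ht.1 (Ne.symm h0)
    apply Real.sin_pos_of_pos_of_lt_pi
    · positivity
    · nlinarith [Real.pi_pos, ht.2]
  have hcos : ∀ t ∈ Set.Icc (0:ℝ) 1, t ≠ 1 → 0 < Real.cos (Real.pi * t / 2) := by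
    intro t ht h0
    have : t < 1 := lt_of_le_of_ne ht.2 h0
    apply Real.cos_pos_of_mem_Ioo
    constructor <;> nlinarith [Real.pi_pos, ht.1]
  have hHp : ∀ v ∈ Set.Icc (0:ℝ) 1, ∀ t ∈ Set.Icc (0:ℝ) 1, Hp (v, t) ≠ 0 := by
    intro v hv t ht
    apply s8_det_ne
    intro w hw h
    obtain ⟨a, b⟩ := hself w hw
    have a' := hZv v hv w hw
    by_cases h0 : t = 0
    · subst h0
      simp at h
      simp [h] at a
    · have := congrArg Complex.im h
      simp only [Matrix.sub_mulVec, Matrix.smul_mulVec, dotProduct_sub, dotProduct_smul,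
      Matrix.one_mulVec, smul_eq_mul, Complex.sub_im, 
      Complex.im_ofReal_mul, b, Complex.zero_im] at this
      have := mul_pos (hsin t ht h0) a'
      linarith
  have hHm : ∀ v ∈ Set.Icc (0:ℝ) 1, ∀ t ∈ Set.Icc (0:ℝ) 1, Hm (v, t) ≠ 0 := by
    intro v hv t ht
    apply s8_det_ne
    intro w hw h
    obtain ⟨a, b⟩ := hGv v hv w hw
    have a' := hZv v hv w hw
    by_cases h0 : t = 1
    · subst h0
      simp at h
      simp [h] at a
    · have := congrArg Complex.im h
      simp only [Matrix.add_mulVec, Matrix.smul_mulVec, dotProduct_add, dotProduct_smul,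
      Matrix.one_mulVec, smul_eq_mul, Complex.add_im, 
      Complex.im_ofReal_mul, b, Complex.zero_im] at this
      have := mul_pos (hcos t ht h0) a'
      linarith
  have cGv : Continuous Gv := by fun_prop
  have cZv : Continuous Zv := by fun_prop
  have cHp : Continuous Hp := by
    apply Continuous.matrix_det
    fun_prop
  have cHm : Continuous Hm := by
    apply Continuous.matrix_det
    fun_prop
  obtain ⟨Lp, cLp, hLp⟩ := s8_lift2 Hp cHp hHp
  obtain ⟨Lm, cLm, hLm⟩ := s8_lift2 Hm cHm hHm
  have m0 : (0:ℝ) ∈ Set.Icc (0:ℝ) 1 := by simp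
  have m1 : (1:ℝ) ∈ Set.Icc (0:ℝ) 1 := by simp
  have Zv0 : Zv 0 = Z := by simp [Zv]
  have Gv0 : Gv 0 = G := by simp [Gv]
  have Zv1 : Zv 1 = Complex.I • 1 := by simp [Zv]
  have Gv1 : Gv 1 = 1 := by simp [Gv]
  refine ⟨fun t => Lp (0, t), fun t => Lm (0, t), by fun_prop, by fun_prop, ?_, ?_, ?_⟩
  · intro t ht
    rw [hLp 0 m0 t ht]
    simp only [Hp, Zv0]
  · intro t ht
    rw [hLm 0 m0 t ht]
    simp only [Hm, Zv0, Gv0]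
  let D : ℝ → ℂ := fun v => (Lp (v, 1) - Lp (v, 0)) + (Lm (v, 1) - Lm (v, 0))
  have cD : Continuous D := by fun_prop
  have hGherm : ∀ v, (Gv v).IsHermitian := by
    intro v
    have := hG.1.eq
    simp [Matrix.IsHermitian, Gv, this]
  have hDim : ∀ v ∈ Set.Icc (0:ℝ) 1, ∃ k : ℤ, (D v).im = k * Real.pi := by
    intro v hv
    have hZd : (Zv v).det ≠ 0 := by
      have := hHm v hv 0 m0
      simpa [Hm] using this
    have e : Complex.exp (D v) = (-1) ^ n * (Gv v).det := by
      simp only [D, Complex.exp_add, Complex.exp_sub, hLp v hv 1 m1, hLp v hv 0 m0,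
        hLm v hv 1 m1, hLm v hv 0 m0]
      simp [Hp, Hm, Matrix.det_neg]
      field_simp
    have im0 : (Complex.exp (D v)).im = 0 := by
      rw [← Complex.conj_eq_iff_im, e]
      have : (starRingEnd ℂ) (Gv v).det = (Gv v).det := by
        rw [starRingEnd_apply, ← Matrix.det_conjTranspose, (hGherm v).eq]
      simp [this]
    rw [Complex.exp_im] at im0
    have : Real.sin (D v).im = 0 := by
      rcases mul_eq_zero.mp im0 with h | h
      · exact absurd h (Real.exp_ne_zero _)
      · exact h
    obtain ⟨k, hk⟩ := Real.sin_eq_zero_iff.mp this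
    exact ⟨k, hk.symm⟩
  have hDc := s8_disc (fun v => (D v).im) (Complex.continuous_im.comp cD).continuousOn Real.pi
    Real.pi_pos (fun t ht => by
      obtain ⟨k, hk⟩ := hDim t ht
      obtain ⟨k0, hk0⟩ := hDim 0 m0
      exact ⟨k - k0, by simp only [hk, hk0]; push_cast; ring⟩)
  -- endpoint computation
  have hend : ∀ (L : ℝ → ℂ) (c : ℂ), Continuous L → c ≠ 0 →
      (∀ t ∈ Set.Icc (0:ℝ) 1, Complex.exp (L t) =
        c * Complex.exp (-(n * (Real.pi * t / 2) : ℝ) * Complex.I)) →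
      (L 1).im - (L 0).im = -(n * Real.pi / 2) := by
    intro L c cL hc h
    have hd := s8_disc (fun t => (L t).im + n * (Real.pi * t / 2)) (by
      have : Continuous fun t => (L t).im := Complex.continuous_im.comp cL
      fun_prop) (2 * Real.pi) (by positivity) (fun t ht => by
        have h1 := h t ht
        have h2 := h 0 m0
        have h3 : Complex.exp (L t + (n * (Real.pi * t / 2) : ℝ) * Complex.I) = Complex.exp (L 0) := by
          rw [Complex.exp_add, h1, h2, mul_assoc, ← Complex.exp_add]
          simp
        rw [Complex.exp_eq_exp_iff_exists_int] at h3
        obtain ⟨k, hk⟩ := h3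
        refine ⟨k, ?_⟩
        have := congrArg Complex.im hk
        simp only [Complex.add_im, Complex.im_ofReal_mul, Complex.I_im] at this
        simp at this
        simp
        linarith)
    linarith
  have e1 := hend (fun t => Lp (1, t)) 1 (by fun_prop) one_ne_zero (fun t ht => by
    rw [hLp 1 m1 t ht]
    simp only [Hp, Zv1, smul_smul, ← sub_smul, Matrix.det_smul, Matrix.det_one, Fintype.card_fin]
    rw [one_mul, mul_one, ← Complex.ofReal_neg, show ((-(n * (Real.pi * t / 2)) : ℝ) : ℂ) * Complex.I = n * ((-(Real.pi * t / 2) : ℝ) * Complex.I) by push_cast; ring,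
      Complex.exp_nat_mul, Complex.exp_mul_I, ← Complex.ofReal_cos, ← Complex.ofReal_sin]
    simp [sub_eq_add_neg])
  have e2 := hend (fun t => Lm (1, t)) (Complex.I ^ n) (by fun_prop) (by simp) (fun t ht => by
    rw [hLm 1 m1 t ht]
    simp only [Hm, Zv1, Gv1, smul_smul, ← add_smul, Matrix.det_smul, Matrix.det_one, Fintype.card_fin]
    rw [mul_one, ← Complex.ofReal_neg, show ((-(n * (Real.pi * t / 2)) : ℝ) : ℂ) * Complex.I = n * ((-(Real.pi * t / 2) : ℝ) * Complex.I) by push_cast; ring,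
      Complex.exp_nat_mul, Complex.exp_mul_I, ← Complex.ofReal_cos, ← Complex.ofReal_sin, ← mul_pow]
    congr 1
    apply Complex.ext <;> simp [add_comm])
  simp only [D, Complex.add_im, Complex.sub_im] at hDc
  linarith

end

section
variable {n : ℕ}

lemma s8_mem_rot (c : ℂ) (v : Fin n → ℂ) :
    v ∈ rotReal n c ↔ ∃ r : Fin n → ℝ, v = c • (fun j => (r j : ℂ)) := by
  simp only [rotReal, Submodule.mem_map, Submodule.mem_top, true_and]
  constructor
  · rintro ⟨r, rfl⟩; exact ⟨r, by ext j; simp⟩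
  · rintro ⟨r, rfl⟩; exact ⟨r, by ext j; simp⟩

lemma s8_mem_lag (A : Matrix (Fin n) (Fin n) ℂ) (v : Fin n → ℂ) :
    v ∈ realLag A ↔ ∃ r : Fin n → ℝ, v = A *ᵥ (fun j => (r j : ℂ)) := by
  simp only [realLag, Submodule.mem_map, Submodule.mem_top, true_and]
  constructor
  · rintro ⟨r, rfl⟩; exact ⟨r, rfl⟩
  · rintro ⟨r, rfl⟩; exact ⟨r, rfl⟩

/-- matrix of the images of the `c • e_j`. -/
noncomputable def s8col (c : ℂ) (E : (Fin n → ℂ) →ₗ[ℝ] (Fin n → ℂ)) : Matrix (Fin n) (Fin n) ℂ :=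
  Matrix.of fun i j => E (Pi.single j c) i

lemma s8_col_mulVec (c : ℂ) (E : (Fin n → ℂ) →ₗ[ℝ] (Fin n → ℂ)) (r : Fin n → ℝ) :
    E (c • (fun j => (r j : ℂ))) = s8col c E *ᵥ (fun j => (r j : ℂ)) := by
  have : (c • (fun j => (r j : ℂ))) = ∑ j, r j • (Pi.single j c : Fin n → ℂ) := by
    ext i
    simp [Finset.sum_apply, Pi.single_apply, mul_comm]
  rw [this, map_sum]
  ext i
  simp [Finset.sum_apply, Matrix.mulVec, dotProduct, s8col, mul_comm]

lemma s8_omega (a b : ℂ) (E : (Fin n → ℂ) →ₗ[ℝ] (Fin n → ℂ))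
    (hE : ∀ v w, omegaC n (E v) (E w) = omegaC n v w) :
    ((s8col a E)ᴴ * s8col b E) - (((s8col a E)ᴴ * s8col b E)).map (starRingEnd ℂ)
      = (2 * Complex.I * ((starRingEnd ℂ a * b).im : ℂ)) • (1 : Matrix (Fin n) (Fin n) ℂ) := by
  have him : ∀ j k, (((s8col a E)ᴴ * s8col b E) j k).im = if j = k then (starRingEnd ℂ a * b).im else 0 := by
    intro j k
    have := hE (Pi.single j a) (Pi.single k b)
    have h2 : (((s8col a E)ᴴ * s8col b E) j k).im = omegaC n (E (Pi.single j a)) (E (Pi.single k b)) := by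
      simp [omegaC, Matrix.mul_apply, s8col]
    rw [h2, this, omegaC, Finset.sum_eq_single j]
    · by_cases h : j = k
      · subst h; simp
      · simp [h, Pi.single_apply]
    · intro i _ hi; simp [hi]
    · simp
  ext j k
  have h := him j k
  rw [Matrix.sub_apply, Matrix.map_apply, Complex.sub_conj, h, Matrix.smul_apply, Matrix.one_apply]
  split_ifs <;> simp; ring

lemma s8_conj (A B : Matrix (Fin n) (Fin n) ℂ) :
    Aᵀ * B.map (starRingEnd ℂ) = (Aᴴ * B).map (starRingEnd ℂ) := by
  rw [Matrix.map_mul]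
  congr 1
  ext i j; simp

lemma s8_inv (E : (Fin n → ℂ) →ₗ[ℝ] (Fin n → ℂ))
    (hE : ∀ v w, omegaC n (E v) (E w) = omegaC n v w) :
    s8col 1 E * (s8col Complex.I E)ᴴ - s8col Complex.I E * (s8col 1 E)ᴴ
      = (-2 * Complex.I) • (1 : Matrix (Fin n) (Fin n) ℂ) := by
  have h11 := s8_omega 1 1 E hE
  have h12 := s8_omega 1 Complex.I E hE
  have h21 := s8_omega Complex.I 1 E hE
  have h22 := s8_omega Complex.I Complex.I E hE
  set X := s8col 1 E
  set Y := s8col Complex.I E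
  simp only [← s8_conj] at h11 h12 h21 h22
  simp at h11 h12 h21 h22
  have hK : Matrix.fromBlocks ((Complex.I/2) • Yᴴ) (-(Complex.I/2) • Yᵀ) (-(Complex.I/2) • Xᴴ) ((Complex.I/2) • Xᵀ)
      * Matrix.fromBlocks X Y (X.map (starRingEnd ℂ)) (Y.map (starRingEnd ℂ)) = 1 := by
    rw [Matrix.fromBlocks_multiply, ← Matrix.fromBlocks_one]
    have e : ∀ A B : Matrix (Fin n) (Fin n) ℂ, ∀ z : ℂ, z • A + (-z) • B = z • (A - B) := by
      intro A B z; rw [smul_sub, neg_smul, sub_eq_add_neg]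
    have e' : ∀ A B : Matrix (Fin n) (Fin n) ℂ, ∀ z : ℂ, (-z) • A + z • B = (-z) • (A - B) := by
      intro A B z; rw [smul_sub, neg_smul, neg_smul, sub_neg_eq_add]
    simp only [Matrix.smul_mul, e, e', h11, h12, h21, h22]
    have q : Complex.I / 2 * (2 * Complex.I) = -1 := by linear_combination Complex.I_mul_I
    congr 1
    · rw [smul_neg, smul_smul, q, neg_smul, one_smul, neg_neg]
    · simp
    · simp
    · rw [smul_smul, neg_mul, q, neg_neg, one_smul]
  have hK' := mul_eq_one_comm.mp hK
  rw [Matrix.fromBlocks_multiply, ← Matrix.fromBlocks_one] at hK'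
  have := (Matrix.fromBlocks_inj.mp hK').1
  have h3 : (Complex.I / 2) • (X * Yᴴ - Y * Xᴴ) = 1 := by
    rw [← this]
    simp [smul_sub, sub_eq_add_neg]
  rw [← h3, smul_smul]
  have : -2 * Complex.I * (Complex.I / 2) = 1 := by
    linear_combination -Complex.I_mul_I
  rw [this, one_smul]

lemma s8_pos (w : Fin n → ℂ) (hw : w ≠ 0) : 0 < (star w ⬝ᵥ w).re := by
  open scoped ComplexOrder in
  have := dotProduct_star_self_pos_iff.mpr hw
  rw [Complex.lt_def] at this
  exact this.1

lemma s8_quad (E : (Fin n → ℂ) →ₗ[ℝ] (Fin n → ℂ))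
    (hE : ∀ v w, omegaC n (E v) (E w) = omegaC n v w) (u : Fin n → ℂ) (hu : u ≠ 0) :
    0 < (star u ⬝ᵥ ((s8col Complex.I E * (s8col 1 E)ᴴ) *ᵥ u)).im := by
  have h := s8_inv E hE
  set X := s8col 1 E
  set Y := s8col Complex.I E
  have h1 : star (star u ⬝ᵥ ((Y * Xᴴ) *ᵥ u)) = star u ⬝ᵥ ((X * Yᴴ) *ᵥ u) := by
    rw [Matrix.star_dotProduct, star_star, Matrix.star_mulVec, Matrix.conjTranspose_mul, Matrix.conjTranspose_conjTranspose,
      Matrix.dotProduct_mulVec]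
  have h2 : star u ⬝ᵥ ((X * Yᴴ - Y * Xᴴ) *ᵥ u) = (-2 * Complex.I) * (star u ⬝ᵥ u) := by
    rw [h, Matrix.smul_mulVec, dotProduct_smul, Matrix.one_mulVec, smul_eq_mul]
  rw [Matrix.sub_mulVec, dotProduct_sub, ← h1] at h2
  have := congrArg Complex.im h2
  simp at this
  have := s8_pos u hu
  linarith

lemma s8_detX (E : (Fin n → ℂ) →ₗ[ℝ] (Fin n → ℂ))
    (hE : ∀ v w, omegaC n (E v) (E w) = omegaC n v w) : (s8col 1 E).det ≠ 0 := by
  have : (s8col Complex.I E * (s8col 1 E)ᴴ).det ≠ 0 := s8_det_ne _ (fun w hw h => by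
    have := s8_quad E hE w hw
    simp [h] at this)
  rw [Matrix.det_mul, Matrix.det_conjTranspose] at this
  intro h
  simp [h] at this

lemma s8_Z (E : (Fin n → ℂ) →ₗ[ℝ] (Fin n → ℂ))
    (hE : ∀ v w, omegaC n (E v) (E w) = omegaC n v w) (w : Fin n → ℂ) (hw : w ≠ 0) :
    0 < (star w ⬝ᵥ (((s8col 1 E)⁻¹ * s8col Complex.I E) *ᵥ w)).im := by
  have hd := s8_detX E hE
  have hq := s8_quad E hE
  set X := s8col 1 E
  set Y := s8col Complex.I E
  have hX : IsUnit X.det := isUnit_iff_ne_zero.mpr hd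
  have hXH : IsUnit (Xᴴ).det := by rw [Matrix.det_conjTranspose]; exact hX.star
  obtain ⟨u, rfl⟩ : ∃ u, w = Xᴴ *ᵥ u := ⟨(Xᴴ)⁻¹ *ᵥ w, by
    rw [Matrix.mulVec_mulVec, Matrix.mul_nonsing_inv _ hXH, Matrix.one_mulVec]⟩
  have hu : u ≠ 0 := by rintro rfl; simp at hw
  have := hq u hu
  convert this using 2
  rw [Matrix.star_mulVec, Matrix.conjTranspose_conjTranspose, ← Matrix.dotProduct_mulVec,
    Matrix.mulVec_mulVec, Matrix.mulVec_mulVec, ← Matrix.mul_assoc X,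
    Matrix.mul_nonsing_inv _ hX, Matrix.one_mul]

open scoped MatrixOrder in
lemma s8_phase (E : (Fin n → ℂ) →ₗ[ℝ] (Fin n → ℂ))
    (hE : ∀ v w, omegaC n (E v) (E w) = omegaC n v w) :
    ∃ A ∈ Matrix.unitaryGroup (Fin n) ℂ, realLag A = Submodule.map E (rotReal n 1) ∧
      A.det ^ 2 = (s8col 1 E).det ^ 2 / (‖(s8col 1 E).det‖ : ℂ) ^ 2 := by
  have hd := s8_detX E hE
  have hom := s8_omega 1 1 E hE
  have hmv := s8_col_mulVec 1 E
  set X := s8col 1 E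
  let S : Matrix (Fin n) (Fin n) ℝ := (X.map Complex.re)ᴴ * (X.map Complex.re) + (X.map Complex.im)ᴴ * (X.map Complex.im)
  have hS : S.PosSemidef := (Matrix.posSemidef_conjTranspose_mul_self _).add
    (Matrix.posSemidef_conjTranspose_mul_self _)
  have hSX : S.map Complex.ofRealHom = Xᴴ * X := by
    ext j k
    have h1 := congrFun (congrFun hom j) k
    rw [Matrix.sub_apply, Matrix.map_apply, Complex.sub_conj] at h1
    simp at h1
    apply Complex.ext
    · simp [S, Matrix.mul_apply, Finset.sum_add_distrib]
    · rw [h1]; simp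
  obtain ⟨B, hB⟩ := CStarAlgebra.nonneg_iff_eq_star_mul_self.mp hS.nonneg
  set Bc := B.map Complex.ofRealHom
  have hBc : Bcᴴ * Bc = Xᴴ * X := by
    rw [← hSX, hB, Matrix.map_mul, Matrix.star_eq_conjTranspose]
    congr 1
    ext i j; simp [Bc]
  have hBdet : Bc.det = ((B.det : ℝ) : ℂ) := by
    have := Complex.ofRealHom.map_det B
    exact this.symm
  have hdet : Bc.det ^ 2 = (‖X.det‖ : ℂ) ^ 2 := by
    have h1 := congrArg Matrix.det hBc
    rw [Matrix.det_mul, Matrix.det_mul, Matrix.det_conjTranspose, Matrix.det_conjTranspose, hBdet] at h1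
    rw [hBdet, ← Complex.conj_mul', sq]
    simpa using h1
  have hBne : Bc.det ≠ 0 := by
    intro h
    rw [h] at hdet
    have h2 := hdet.symm
    simp at h2
    exact hd h2
  have hBu : IsUnit Bc.det := isUnit_iff_ne_zero.mpr hBne
  have hBr : IsUnit B.det := by
    rw [isUnit_iff_ne_zero]
    intro h; rw [hBdet, h] at hBne; simp at hBne
  have hcast : ∀ r : Fin n → ℝ, Bc *ᵥ (fun j => (r j : ℂ)) = fun j => (((B *ᵥ r) j : ℝ) : ℂ) := by
    intro r
    ext i
    simp [Bc, Matrix.mulVec, dotProduct]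
  refine ⟨X * Bc⁻¹, ?_, ?_, ?_⟩
  · rw [Matrix.mem_unitaryGroup_iff', Matrix.star_eq_conjTranspose, Matrix.conjTranspose_mul,
      Matrix.mul_assoc, ← Matrix.mul_assoc Xᴴ, ← hBc, Matrix.mul_assoc, Matrix.mul_nonsing_inv _ hBu,
      Matrix.mul_one, ← Matrix.conjTranspose_mul, Matrix.mul_nonsing_inv _ hBu, Matrix.conjTranspose_one]
  · ext v
    rw [s8_mem_lag, Submodule.mem_map]
    constructor
    · rintro ⟨r, rfl⟩
      refine ⟨(1:ℂ) • fun j => (((B⁻¹ *ᵥ r) j : ℝ) : ℂ), (s8_mem_rot _ _).mpr ⟨_, rfl⟩, ?_⟩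
      rw [hmv, ← Matrix.mulVec_mulVec]
      congr 1
      have := hcast (B⁻¹ *ᵥ r)
      rw [Matrix.mulVec_mulVec, Matrix.mul_nonsing_inv _ hBr, Matrix.one_mulVec] at this
      rw [← this, Matrix.mulVec_mulVec, Matrix.nonsing_inv_mul _ hBu, Matrix.one_mulVec]
    · rintro ⟨y, hy, rfl⟩
      obtain ⟨r, rfl⟩ := (s8_mem_rot _ _).mp hy
      refine ⟨B *ᵥ r, ?_⟩
      rw [hmv, ← hcast, Matrix.mulVec_mulVec, Matrix.mul_assoc, Matrix.nonsing_inv_mul _ hBu, Matrix.mul_one]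
  · rw [Matrix.det_mul, Matrix.det_nonsing_inv, mul_pow, Ring.inverse_eq_inv', inv_pow, hdet, div_eq_mul_inv]

/-- multiplication by the unit complex number, followed by `E`. -/
noncomputable def s8rot (c : ℂ) (E : (Fin n → ℂ) →ₗ[ℝ] (Fin n → ℂ)) : (Fin n → ℂ) →ₗ[ℝ] (Fin n → ℂ) :=
  E.comp ((LinearMap.lsmul ℂ (Fin n → ℂ) c).restrictScalars ℝ)

lemma s8_phase_t (E : (Fin n → ℂ) →ₗ[ℝ] (Fin n → ℂ))
    (hE : ∀ v w, omegaC n (E v) (E w) = omegaC n v w) (β : ℝ → ℂ)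
    (hβ : ∀ t ∈ Set.Icc (0 : ℝ) 1, ∀ A ∈ Matrix.unitaryGroup (Fin n) ℂ,
      realLag A = Submodule.map E
        (rotReal n (Complex.exp (-(Real.pi * t / 2) * Complex.I))) →
      β t = A.det ^ 2) (t : ℝ) (ht : t ∈ Set.Icc (0:ℝ) 1) :
    β t = ((Real.cos (Real.pi * t / 2) : ℂ) • s8col 1 E
        - (Real.sin (Real.pi * t / 2) : ℂ) • s8col Complex.I E).det ^ 2 /
      (‖((Real.cos (Real.pi * t / 2) : ℂ) • s8col 1 E
        - (Real.sin (Real.pi * t / 2) : ℂ) • s8col Complex.I E).det‖ : ℂ) ^ 2 := by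
  set c := Complex.exp (-(Real.pi * t / 2) * Complex.I) with hc
  have hce : c = (Real.cos (Real.pi * t / 2) : ℂ) - (Real.sin (Real.pi * t / 2) : ℂ) * Complex.I := by
    rw [hc, Complex.exp_mul_I]
    push_cast
    rw [Complex.cos_neg, Complex.sin_neg]; ring
  have hcc : (starRingEnd ℂ) c * c = 1 := by
    rw [Complex.conj_mul', hc]
    have : (-((Real.pi:ℂ) * t / 2) * Complex.I) = ((-(Real.pi * t / 2) : ℝ) : ℂ) * Complex.I := by push_cast; ring
    rw [this, Complex.norm_exp_ofReal_mul_I]; simp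
  have hF : ∀ v w, omegaC n (s8rot c E v) (s8rot c E w) = omegaC n v w := by
    intro v w
    have : ∀ v, s8rot c E v = E (c • v) := fun v => rfl
    rw [this, this, hE, omegaC, omegaC]
    congr 1
    apply Finset.sum_congr rfl
    intro i _
    simp only [Pi.smul_apply, smul_eq_mul, map_mul]
    linear_combination ((starRingEnd ℂ) (v i) * w i) * hcc
  obtain ⟨A, hA, hl, hdet⟩ := s8_phase (s8rot c E) hF
  have hcol : s8col 1 (s8rot c E) = (Real.cos (Real.pi * t / 2) : ℂ) • s8col 1 E
        - (Real.sin (Real.pi * t / 2) : ℂ) • s8col Complex.I E := by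
    ext i j
    have h1 : s8rot c E (Pi.single j 1) = E (c • Pi.single j 1) := rfl
    have h2 : (c • Pi.single j 1 : Fin n → ℂ) = Real.cos (Real.pi * t / 2) • (Pi.single j 1 : Fin n → ℂ)
        - Real.sin (Real.pi * t / 2) • (Pi.single j Complex.I : Fin n → ℂ) := by
      rw [hce]
      ext k
      by_cases h : k = j
      · subst h; simp
      · simp [h]
    simp only [s8col, Matrix.of_apply, h1, h2, map_sub, map_smul, Matrix.sub_apply, Matrix.smul_apply]
    simp
  rw [← hcol, ← hdet]
  apply hβ t ht A hA
  rw [hl, ← hc]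
  clear_value c
  ext v
  simp only [Submodule.mem_map, s8_mem_rot]
  constructor
  · rintro ⟨y, ⟨r, rfl⟩, rfl⟩
    exact ⟨_, ⟨r, rfl⟩, by simp [s8rot]⟩
  · rintro ⟨y, ⟨r, rfl⟩, rfl⟩
    exact ⟨_, ⟨r, rfl⟩, by simp [s8rot]⟩

lemma s8_sub_of (E E' : (Fin n → ℂ) →ₗ[ℝ] (Fin n → ℂ)) (c c' : ℂ)
    (h : Submodule.map E' (rotReal n c') = Submodule.map E (rotReal n c)) :
    ∃ P : Matrix (Fin n) (Fin n) ℝ, s8col c' E' = s8col c E * P.map Complex.ofRealHom := by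
  have : ∀ j, ∃ r : Fin n → ℝ, E' (Pi.single j c') = s8col c E *ᵥ (fun j => (r j : ℂ)) := by
    intro j
    have hm : E' (Pi.single j c') ∈ Submodule.map E' (rotReal n c') :=
      Submodule.mem_map_of_mem ((s8_mem_rot _ _).mpr ⟨Pi.single j 1, by
        ext k
        by_cases hk : k = j
        · subst hk; simp
        · simp [hk]⟩)
    rw [h] at hm
    obtain ⟨y, hy, he⟩ := hm
    obtain ⟨r, rfl⟩ := (s8_mem_rot _ _).mp hy
    exact ⟨r, by rw [← he, ← s8_col_mulVec]⟩
  choose r hr using this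
  refine ⟨Matrix.of fun i j => r j i, ?_⟩
  ext i j
  have := congrFun (hr j) i
  simp only [s8col, Matrix.of_apply] at this ⊢
  rw [this]
  simp [Matrix.mul_apply, Matrix.mulVec, dotProduct, s8col]

end

open scoped ComplexOrder in
lemma s8_posdef {n : ℕ} (P : Matrix (Fin n) (Fin n) ℂ) (h : P.det ≠ 0) : (P * Pᴴ).PosDef := by
  have hi : Function.Injective P.vecMul :=
    Matrix.vecMul_injective_iff_isUnit.mpr ((Matrix.isUnit_iff_isUnit_det P).mpr (isUnit_iff_ne_zero.mpr h))
  exact Matrix.PosDef.mul_conjTranspose_self P hi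

theorem stmt8 (n : ℕ) (hn : 1 ≤ n)
    (L₀ L₁ : Submodule ℝ (Fin n → ℂ))
    (hL₀dim : Module.finrank ℝ L₀ = n) (hL₁dim : Module.finrank ℝ L₁ = n)
    (hL₀ : ∀ v ∈ L₀, ∀ w ∈ L₀, omegaC n v w = 0)
    (hL₁ : ∀ v ∈ L₁, ∀ w ∈ L₁, omegaC n v w = 0)
    (htrans : L₀ ⊓ L₁ = ⊥)
    (C C' : (Fin n → ℂ) ≃ₗ[ℝ] (Fin n → ℂ))
    (hC : ∀ v w : Fin n → ℂ, omegaC n (C v) (C w) = omegaC n v w)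
    (hC' : ∀ v w : Fin n → ℂ, omegaC n (C' v) (C' w) = omegaC n v w)
    (hC0 : Submodule.map (C : (Fin n → ℂ) →ₗ[ℝ] (Fin n → ℂ)) L₀ = rotReal n 1)
    (hC1 : Submodule.map (C : (Fin n → ℂ) →ₗ[ℝ] (Fin n → ℂ)) L₁ = rotReal n Complex.I)
    (hC'1 : Submodule.map (C' : (Fin n → ℂ) →ₗ[ℝ] (Fin n → ℂ)) L₁ = rotReal n 1)
    (hC'0 : Submodule.map (C' : (Fin n → ℂ) →ₗ[ℝ] (Fin n → ℂ)) L₀ = rotReal n Complex.I)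
    (βp βm : ℝ → ℂ)
    -- `β₊(t)` is the squared-determinant phase of `λ₊(t) = C⁻¹(e^{-iπt/2}·ℝⁿ)`
    (hβp : ∀ t ∈ Set.Icc (0 : ℝ) 1, ∀ A ∈ Matrix.unitaryGroup (Fin n) ℂ,
      realLag A = Submodule.map (C.symm : (Fin n → ℂ) →ₗ[ℝ] (Fin n → ℂ))
        (rotReal n (Complex.exp (-(Real.pi * t / 2) * Complex.I))) →
      βp t = A.det ^ 2)
    -- `β₋(t)` is the squared-determinant phase of `λ₋(t) = C'⁻¹(e^{-iπt/2}·ℝⁿ)`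
    (hβm : ∀ t ∈ Set.Icc (0 : ℝ) 1, ∀ A ∈ Matrix.unitaryGroup (Fin n) ℂ,
      realLag A = Submodule.map (C'.symm : (Fin n → ℂ) →ₗ[ℝ] (Fin n → ℂ))
        (rotReal n (Complex.exp (-(Real.pi * t / 2) * Complex.I))) →
      βm t = A.det ^ 2)
    (a₀ a₁ : ℝ) (αp αm : ℝ → ℝ)
    (hαpc : ContinuousOn αp (Set.Icc 0 1)) (hαmc : ContinuousOn αm (Set.Icc 0 1))
    (hαp : ∀ t ∈ Set.Icc (0 : ℝ) 1,
      Complex.exp (2 * Real.pi * Complex.I * (αp t)) = βp t)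
    (hαm : ∀ t ∈ Set.Icc (0 : ℝ) 1,
      Complex.exp (2 * Real.pi * Complex.I * (αm t)) = βm t)
    (hαp0 : αp 0 = a₀) (hαm0 : αm 0 = a₁) :
    (a₁ - αp 1) + (a₀ - αm 1) = n := by
  have hE : ∀ v w, omegaC n ((C.symm : (Fin n → ℂ) →ₗ[ℝ] (Fin n → ℂ)) v)
      ((C.symm : (Fin n → ℂ) →ₗ[ℝ] (Fin n → ℂ)) w) = omegaC n v w := by
    intro v w
    have := hC (C.symm v) (C.symm w)
    simpa using this.symm
  have hE' : ∀ v w, omegaC n ((C'.symm : (Fin n → ℂ) →ₗ[ℝ] (Fin n → ℂ)) v)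
      ((C'.symm : (Fin n → ℂ) →ₗ[ℝ] (Fin n → ℂ)) w) = omegaC n v w := by
    intro v w
    have := hC' (C'.symm v) (C'.symm w)
    simpa using this.symm
  have hback : ∀ (D : (Fin n → ℂ) ≃ₗ[ℝ] (Fin n → ℂ)) (L : Submodule ℝ (Fin n → ℂ)),
      Submodule.map (D.symm : (Fin n → ℂ) →ₗ[ℝ] (Fin n → ℂ))
        (Submodule.map (D : (Fin n → ℂ) →ₗ[ℝ] (Fin n → ℂ)) L) = L := by
    intro D L
    rw [← Submodule.map_comp]
    simp
  have r0 := hback C L₀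
  have r1 := hback C L₁
  have r0' := hback C' L₀
  have r1' := hback C' L₁
  rw [hC0] at r0
  rw [hC1] at r1
  rw [hC'0] at r0'
  rw [hC'1] at r1'
  have hbp := s8_phase_t _ hE βp hβp
  have hbm := s8_phase_t _ hE' βm hβm
  obtain ⟨P, hP⟩ := s8_sub_of _ _ _ _ (r0'.trans r0.symm)
  obtain ⟨Q, hQ⟩ := s8_sub_of _ _ _ _ (r1'.trans r1.symm)
  have hdX := s8_detX _ hE
  have hZ := s8_Z _ hE
  have ho := s8_omega Complex.I 1 _ hE
  have ho' := s8_omega 1 Complex.I _ hE'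
  set X := s8col 1 (C.symm : (Fin n → ℂ) →ₗ[ℝ] (Fin n → ℂ))
  set Y := s8col Complex.I (C.symm : (Fin n → ℂ) →ₗ[ℝ] (Fin n → ℂ))
  rw [hP, hQ] at ho'
  simp only [hP, hQ] at hbm
  set Pc := P.map Complex.ofRealHom
  set Qc := Q.map Complex.ofRealHom
  have hPconj : Pc.map (starRingEnd ℂ) = Pc := by ext i j; simp [Pc]
  have hQconj : (Qcᴴ).map (starRingEnd ℂ) = Qcᴴ := by ext i j; simp [Qc]
  have hQP : Qcᴴ * Pc = -1 := by
    have e1 : (Y * Qc)ᴴ * (X * Pc) = Qcᴴ * (Yᴴ * X) * Pc := by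
      rw [Matrix.conjTranspose_mul]; simp only [Matrix.mul_assoc]
    rw [e1, Matrix.map_mul, Matrix.map_mul, hPconj, hQconj, ← Matrix.sub_mul, ← Matrix.mul_sub, ho] at ho'
    simp only [Matrix.mul_smul, Matrix.smul_mul, Matrix.mul_one] at ho'
    simp only [map_one, one_mul, Complex.I_im, mul_one, Complex.conj_I, Complex.neg_im,
      Complex.ofReal_neg, Complex.ofReal_one, mul_neg, neg_smul] at ho'
    have h2 : (2 * Complex.I) ≠ 0 := by simp
    have := congrArg (fun M => (2 * Complex.I)⁻¹ • M) ho'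
    simp only [smul_neg, smul_smul, inv_mul_cancel₀ h2, one_smul] at this
    rw [← this, neg_neg]
  have hPQ : Pcᴴ * Qc = -1 := by
    have := congrArg Matrix.conjTranspose hQP
    simpa using this
  have hdPQ : Pc.det ≠ 0 ∧ Qc.det ≠ 0 := by
    have h1 : (-(Qcᴴ) * Pc).det = 1 := by rw [Matrix.neg_mul, hQP, neg_neg, Matrix.det_one]
    have h2 : (-(Pcᴴ) * Qc).det = 1 := by rw [Matrix.neg_mul, hPQ, neg_neg, Matrix.det_one]
    rw [Matrix.det_mul] at h1 h2
    exact ⟨right_ne_zero_of_mul (h1.trans_ne one_ne_zero), right_ne_zero_of_mul (h2.trans_ne one_ne_zero)⟩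
  have hXu : IsUnit X.det := isUnit_iff_ne_zero.mpr hdX
  obtain ⟨lp, lm, clp, clm, hlp, hlm, htot⟩ := s8_total (Pc * Pcᴴ) (X⁻¹ * Y) (s8_posdef Pc hdPQ.1) hZ
  have hY : Y = X * (X⁻¹ * Y) := by
    rw [← Matrix.mul_assoc, Matrix.mul_nonsing_inv _ hXu, Matrix.one_mul]
  have A1 := s8_alpha αp hαpc lp clp X.det hdX (fun t ht => by
    rw [hαp t ht, hbp t ht, hlp t ht, ← Matrix.det_mul, Matrix.mul_sub, Matrix.mul_smul, Matrix.mul_smul,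
      Matrix.mul_one, ← hY])
  have A2 := s8_alpha αm hαmc lm clm (X.det * Qc.det) (mul_ne_zero hdX hdPQ.2) (fun t ht => by
    have e : X.det * Qc.det * ((Real.sin (Real.pi * t / 2) : ℂ) • (Pc * Pcᴴ) + (Real.cos (Real.pi * t / 2) : ℂ) • (X⁻¹ * Y)).det
        = ((Real.cos (Real.pi * t / 2) : ℂ) • (Y * Qc) - (Real.sin (Real.pi * t / 2) : ℂ) • (X * Pc)).det := by
      rw [mul_right_comm, ← Matrix.det_mul, ← Matrix.det_mul]
      congr 1
      rw [Matrix.mul_add, Matrix.mul_smul, Matrix.mul_smul, ← hY, Matrix.add_mul, Matrix.smul_mul, Matrix.smul_mul,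
        Matrix.mul_assoc X, Matrix.mul_assoc Pc, hPQ, Matrix.mul_neg, Matrix.mul_neg, Matrix.mul_one, smul_neg]
      abel
    rw [hαm t ht, hbm t ht, hlm t ht, e])
  rw [hαp0] at A1
  rw [hαm0] at A2
  have : Real.pi * ((a₁ - αp 1) + (a₀ - αm 1)) = Real.pi * n := by linarith
  exact mul_left_cancel₀ Real.pi_ne_zero this
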